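/- arXiv:2203.14504 — 5 statements merged into one kernel-verified Lean document; each statement's English description precedes it below -/
import Mathlib

section
/- For each n ∈ ℕ let 𝒻_n be a nonempty index family. For each F ∈ 𝒻_n, let θ̂_n be a real random variable on a probability space with probability measure F, let H_n : ℝ → [0,1] be the cumulative distribution function of θ̂_n under F (i.e., H_n(t) = F{θ̂_n ≤ t}), and let Ĥ_n be a random nondecreasing function from ℝ to [0,1] defined on the same probability space (an estimator of H_n). For a nondecreasing G : ℝ → [0,1], write G⁻¹(p) = inf{ t ∈ ℝ : G(t) ≥ p } (with the convention inf ∅ = +∞). Fix α ∈ (0,1). If for every ε > 0, lim_{n→∞} sup_{F ∈ 𝒻_n} F{ sup_{t ∈ ℝ} |Ĥ_n(t) − H_n(t)| ≥ ε } = 0, then liminf_{n→∞} inf_{F ∈ 𝒻_n} F{ Ĥ_n⁻¹(α/2) ≤ θ̂_n ≤ Ĥ_n⁻¹(1 − α/2) } ≥ 1 − α. -/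
open MeasureTheory Filter

/-- Generalized inverse (quantile function) of a nondecreasing function `K : ℝ → ℝ`:
`K⁻¹(p) = inf { t : K t ≥ p }`, valued in the extended reals, with `inf ∅ = +∞`. -/
noncomputable def qinv (K : ℝ → ℝ) (p : ℝ) : EReal :=
  sInf ((fun t : ℝ => (t : EReal)) '' {t : ℝ | p ≤ K t})

lemma aux_le_of_compact (μ : Measure ℝ) [IsProbabilityMeasure μ] (S : Set ℝ)
    (hS : MeasurableSet S) (u : ℝ) (hu : 0 ≤ u)
    (h : ∀ K ⊆ S, IsCompact K → K.Nonempty → μ.real K ≤ u) : μ.real S ≤ u := by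
  have : μ S ≤ ENNReal.ofReal u := by
    rw [hS.measure_eq_iSup_isCompact μ]
    refine iSup_le fun K => iSup_le fun hK => iSup_le fun hc => ?_
    rcases K.eq_empty_or_nonempty with rfl | hne
    · simp
    · rw [← ofReal_measureReal]
      exact ENNReal.ofReal_le_ofReal (h K hK hc hne)
  exact ENNReal.toReal_le_of_le_ofReal hu this

lemma aux_lower (μ : Measure ℝ) [IsProbabilityMeasure μ] (u : ℝ) (hu : 0 ≤ u) :
    μ.real {x | μ.real (Set.Iic x) < u} ≤ u := by
  refine aux_le_of_compact μ _ ?_ u hu ?_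
  · apply Set.OrdConnected.measurableSet
    refine ⟨fun x _ y hy z hz => ?_⟩
    exact lt_of_le_of_lt (measureReal_mono (Set.Iic_subset_Iic.2 hz.2)) hy
  · intro K hK hc hne
    obtain ⟨m, hm, hmax⟩ := hc.exists_isGreatest hne
    have h1 : μ.real K ≤ μ.real (Set.Iic m) := measureReal_mono (fun x hx => hmax hx)
    exact h1.trans (le_of_lt (hK hm))

lemma aux_upper (μ : Measure ℝ) [IsProbabilityMeasure μ] (c : ℝ) (hc1 : c ≤ 1) :
    μ.real {x | ∃ t < x, c < μ.real (Set.Iic t)} ≤ 1 - c := by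
  refine aux_le_of_compact μ _ ?_ _ (by linarith) ?_
  · apply Set.OrdConnected.measurableSet
    refine ⟨fun x hx y _ z hz => ?_⟩
    obtain ⟨t, ht, h⟩ := hx
    exact ⟨t, lt_of_lt_of_le ht hz.1, h⟩
  · intro K hK hc hne
    obtain ⟨m, hm, hmin⟩ := hc.exists_isLeast hne
    obtain ⟨t, ht, h⟩ := hK hm
    have h1 : μ.real K ≤ μ.real (Set.Iic t)ᶜ :=
      measureReal_mono (fun x hx => by
        have := hmin hx
        simp only [Set.mem_compl_iff, Set.mem_Iic, not_le]
        exact lt_of_lt_of_le ht this)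
    rw [probReal_compl_eq_one_sub measurableSet_Iic] at h1
    linarith

lemma aux_cover {Ω : Type*} [MeasurableSpace Ω] (P : Measure Ω) [IsProbabilityMeasure P]
    (θ : Ω → ℝ) (hθ : Measurable θ) (H : ℝ → ℝ)
    (hH : ∀ t, H t = (P {ω | θ ω ≤ t}).toReal)
    (G : Ω → ℝ → ℝ) (hrange : ∀ ω t, G ω t ∈ Set.Icc (0 : ℝ) 1)
    (α : ℝ) (hα : α ∈ Set.Ioo (0 : ℝ) 1) (ε : ℝ) (hε : 0 < ε) :
    1 - α - 2 * ε - (P {ω | ε ≤ ⨆ t : ℝ, |G ω t - H t|}).toReal ≤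
      (P {ω | qinv (G ω) (α / 2) ≤ (θ ω : EReal) ∧
              (θ ω : EReal) ≤ qinv (G ω) (1 - α / 2)}).toReal := by
  obtain ⟨hα0, hα1⟩ := hα
  have := Measure.isProbabilityMeasure_map (μ := P) hθ.aemeasurable
  set μ := P.map θ with hμ
  have hHμ : ∀ t, H t = μ.real (Set.Iic t) := fun t => by
    rw [hH, Measure.real, hμ, Measure.map_apply hθ measurableSet_Iic]; rfl
  have hle : ∀ S : Set ℝ, P.real (θ ⁻¹' S) ≤ μ.real S := fun S =>
    ENNReal.toReal_mono (measure_ne_top _ _) (Measure.le_map_apply hθ.aemeasurable S)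
  have h1 := (hle _).trans (aux_lower μ (α / 2 + ε) (by linarith))
  have h2 := (hle _).trans (aux_upper μ (1 - α / 2 - ε) (by linarith))
  set T := {ω | qinv (G ω) (α / 2) ≤ (θ ω : EReal) ∧
              (θ ω : EReal) ≤ qinv (G ω) (1 - α / 2)} with hT
  set D := {ω | ε ≤ ⨆ t : ℝ, |G ω t - H t|} with hD
  set B := θ ⁻¹' {x | μ.real (Set.Iic x) < α / 2 + ε} with hB
  set C := θ ⁻¹' {x | ∃ t < x, 1 - α / 2 - ε < μ.real (Set.Iic t)} with hC
  have hcov : (Set.univ : Set Ω) ⊆ T ∪ D ∪ B ∪ C := by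
    intro ω _
    by_contra hn
    simp only [Set.mem_union, not_or] at hn
    obtain ⟨⟨⟨hnT, hnD⟩, hnB⟩, hnC⟩ := hn
    apply hnT
    have hbdd : BddAbove (Set.range fun t : ℝ => |G ω t - H t|) := by
      refine ⟨1, ?_⟩
      rintro _ ⟨t, rfl⟩
      have a1 := hrange ω t
      have a2 : 0 ≤ H t := by rw [hHμ]; exact measureReal_nonneg
      have a3 : H t ≤ 1 := by rw [hHμ]; exact measureReal_le_one
      rw [abs_le]
      constructor <;> linarith [a1.1, a1.2]
    have hlt : ∀ t, |G ω t - H t| < ε := fun t =>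
      lt_of_le_of_lt (le_ciSup hbdd t) (not_le.1 hnD)
    constructor
    · apply sInf_le
      refine ⟨θ ω, ?_, rfl⟩
      have a := abs_lt.1 (hlt (θ ω))
      have b : α / 2 + ε ≤ μ.real (Set.Iic (θ ω)) := not_lt.1 hnB
      rw [← hHμ] at b
      simp only [Set.mem_ofPred_eq]
      linarith [a.1]
    · apply le_sInf
      rintro _ ⟨t, ht, rfl⟩
      simp only [Set.mem_ofPred_eq] at ht
      by_contra hlt'
      have hlt2 : t < θ ω := by simpa using hlt'
      apply hnC
      refine ⟨t, hlt2, ?_⟩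
      rw [← hHμ]
      linarith [(abs_lt.1 (hlt t)).2]
  have h3 : P.real (Set.univ : Set Ω) ≤ P.real T + P.real D + P.real B + P.real C := by
    refine (measureReal_mono hcov).trans ?_
    have e1 := measureReal_union_le (μ := P) (T ∪ D ∪ B) C
    have e2 := measureReal_union_le (μ := P) (T ∪ D) B
    have e3 := measureReal_union_le (μ := P) T D
    linarith
  rw [probReal_univ] at h3
  change 1 - α - 2 * ε - P.real D ≤ P.real T
  linarith

/-- Lemma 2 of the paper: uniform consistency in probability of an estimated CDF
implies asymptotic coverage of the quantile-inversion confidence interval, uniformly over a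
family of data-generating distributions.

For each n, `ι n` indexes the family 𝒻_n of data-generating distributions; `P n F` is the
probability measure indexed by `F`, `θhat n F` the real statistic, `H n F` its CDF under `P n F`,
and `Hhat n F` the (random, nondecreasing, [0,1]-valued) estimated CDF. -/
theorem uniform_cdf_consistency_implies_coverage
    (Ω : ℕ → Type*) [∀ n, MeasurableSpace (Ω n)]
    (ι : ℕ → Type*) [∀ n, Nonempty (ι n)]
    (P : ∀ n, ι n → Measure (Ω n)) (hP : ∀ n F, IsProbabilityMeasure (P n F))
    (θhat : ∀ n, ι n → Ω n → ℝ) (hθ : ∀ n F, Measurable (θhat n F))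
    (H : ∀ n, ι n → ℝ → ℝ)
    (hH : ∀ n F t, H n F t = ((P n F) {ω | θhat n F ω ≤ t}).toReal)
    (Hhat : ∀ n, ι n → Ω n → ℝ → ℝ)
    (hmono : ∀ n F ω, Monotone (Hhat n F ω))
    (hrange : ∀ n F ω t, Hhat n F ω t ∈ Set.Icc (0 : ℝ) 1)
    (α : ℝ) (hα : α ∈ Set.Ioo (0 : ℝ) 1)
    (hconsist : ∀ ε > (0 : ℝ),
      Tendsto (fun n => ⨆ F : ι n,
          ((P n F) {ω | ε ≤ ⨆ t : ℝ, |Hhat n F ω t - H n F t|}).toReal)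
        atTop (nhds 0)) :
    1 - α ≤
      liminf (fun n => ⨅ F : ι n,
          ((P n F) {ω | qinv (Hhat n F ω) (α / 2) ≤ (θhat n F ω : EReal) ∧
              (θhat n F ω : EReal) ≤ qinv (Hhat n F ω) (1 - α / 2)}).toReal)
        atTop := by
  have hle1 : ∀ n (F : ι n) (S : Set (Ω n)), ((P n F) S).toReal ≤ 1 := fun n F S => by
    have := hP n F
    exact measureReal_le_one
  refine le_of_forall_pos_le_add fun δ hδ => ?_
  rw [← sub_le_iff_le_add]
  have hev := (hconsist (δ / 3) (by positivity)).eventually_lt_const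
    (show (0 : ℝ) < δ / 3 by positivity)
  refine le_liminf_of_le ?_ ?_
  · apply IsBoundedUnder.isCoboundedUnder_ge
    refine isBoundedUnder_of ⟨1, fun n => ?_⟩
    obtain ⟨F⟩ := (inferInstance : Nonempty (ι n))
    refine (ciInf_le ⟨0, ?_⟩ F).trans (hle1 n F _)
    rintro _ ⟨F, rfl⟩
    exact ENNReal.toReal_nonneg
  · filter_upwards [hev] with n hn
    refine le_ciInf fun F => ?_
    have := hP n F
    refine le_trans ?_ (aux_cover (P n F) (θhat n F) (hθ n F) (H n F) (hH n F) (Hhat n F)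
      (hrange n F) α hα (δ / 3) (by positivity))
    have hb := le_ciSup (f := fun F : ι n =>
      ((P n F) {ω | δ / 3 ≤ ⨆ t : ℝ, |Hhat n F ω t - H n F t|}).toReal)
      ⟨1, by rintro _ ⟨F, rfl⟩; exact hle1 n F _⟩ F
    linarith
end

section
/- Let θ̂ be a real random variable on a probability space (Ω, P) with cumulative distribution function H (i.e., H(t) = P(θ̂ ≤ t)), and let Ĥ : Ω → (ℝ → [0,1]) be a random nondecreasing function on the same space. For a nondecreasing G : ℝ → [0,1], write G⁻¹(p) = inf{ t ∈ ℝ : G(t) ≥ p } (with inf ∅ = +∞). Then for every q ∈ (0,1) and every ε ∈ (0, q): P( θ̂ ≤ Ĥ⁻¹(q) ) ≥ q − ε − P( sup_{t ∈ ℝ} |Ĥ(t) − H(t)| ≥ ε ). -/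
open MeasureTheory

/-- one-sided inequality from the proof of Lemma 2 of the paper.
If H is the CDF of θ̂ under P and Ĥ : Ω → (ℝ → [0,1]) is a random nondecreasing function,
then for every q ∈ (0,1) and ε ∈ (0,q),
P(θ̂ ≤ Ĥ⁻¹(q)) ≥ q − ε − P(sup_t |Ĥ(t) − H(t)| ≥ ε). -/
theorem one_sided_coverage_bound
    {Ω : Type*} [MeasurableSpace Ω] (P : Measure Ω) [IsProbabilityMeasure P]
    (θhat : Ω → ℝ) (hθ : Measurable θhat)
    (H : ℝ → ℝ) (hH : ∀ t, H t = (P {ω | θhat ω ≤ t}).toReal)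
    (Hhat : Ω → ℝ → ℝ)
    (hmono : ∀ ω, Monotone (Hhat ω))
    (hrange : ∀ ω t, Hhat ω t ∈ Set.Icc (0 : ℝ) 1)
    (q ε : ℝ) (hq : q ∈ Set.Ioo (0 : ℝ) 1) (hε : ε ∈ Set.Ioo (0 : ℝ) q) :
    (P {ω | (θhat ω : EReal) ≤ qinv (Hhat ω) q}).toReal ≥
      q - ε - (P {ω | ε ≤ ⨆ t : ℝ, |Hhat ω t - H t|}).toReal := by
  obtain ⟨hq0, hq1⟩ := hq
  obtain ⟨hε0, hεq⟩ := hε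
  have hcdf : ∀ t, H t = ProbabilityTheory.cdf (P.map θhat) t := by
    intro t
    haveI : IsProbabilityMeasure (P.map θhat) :=
      Measure.isProbabilityMeasure_map hθ.aemeasurable
    rw [hH, ProbabilityTheory.cdf_eq_real, measureReal_def,
      Measure.map_apply hθ measurableSet_Iic]
    rfl
  have hHfun : H = ProbabilityTheory.cdf (P.map θhat) := funext hcdf
  have hHmono : Monotone H := by
    rw [hHfun]; exact ProbabilityTheory.monotone_cdf _
  have hne : {t | q - ε ≤ H t}.Nonempty := by
    have h1 := ProbabilityTheory.tendsto_cdf_atTop (P.map θhat)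
    rw [← hHfun] at h1
    obtain ⟨t, ht⟩ := (h1.eventually (lt_mem_nhds (show q - ε < 1 by linarith))).exists
    exact ⟨t, ht.le⟩
  have hbdd : BddBelow {t | q - ε ≤ H t} := by
    have h1 := ProbabilityTheory.tendsto_cdf_atBot (P.map θhat)
    rw [← hHfun] at h1
    obtain ⟨t, ht⟩ := (h1.eventually (gt_mem_nhds (show 0 < q - ε by linarith))).exists
    refine ⟨t, fun u hu => ?_⟩
    by_contra hlt
    have := hHmono (not_le.mp hlt).le
    have hu' : q - ε ≤ H u := hu
    linarith
  set s := sInf {t | q - ε ≤ H t} with hs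
  have hHs : q - ε ≤ H s := by
    have hrc : ContinuousWithinAt H (Set.Ioi s) s := by
      rw [hHfun]
      exact ((ProbabilityTheory.cdf (P.map θhat)).right_continuous s).mono Set.Ioi_subset_Ici_self
    refine ge_of_tendsto hrc ?_
    filter_upwards [self_mem_nhdsWithin] with t ht
    obtain ⟨u, hu, hut⟩ := exists_lt_of_csInf_lt hne (show sInf {t | q - ε ≤ H t} < t from ht)
    exact le_trans hu (hHmono hut.le)
  have hsub : {ω | θhat ω ≤ s} ⊆ {ω | (θhat ω : EReal) ≤ qinv (Hhat ω) q} ∪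
      {ω | ε ≤ ⨆ t : ℝ, |Hhat ω t - H t|} := by
    intro ω hω
    by_cases hB : ε ≤ ⨆ t : ℝ, |Hhat ω t - H t|
    · exact Or.inr hB
    · left
      have hω' : θhat ω ≤ s := hω
      show (θhat ω : EReal) ≤ sInf _
      refine le_sInf ?_
      rintro _ ⟨t, ht, rfl⟩
      have ht' : q ≤ Hhat ω t := ht
      have hbd : BddAbove (Set.range fun t : ℝ => |Hhat ω t - H t|) := by
        refine ⟨1, ?_⟩
        rintro _ ⟨u, rfl⟩
        have h1 := hrange ω u
        have h2 : 0 ≤ H u := by rw [hcdf]; exact ProbabilityTheory.cdf_nonneg _ _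
        have h3 : H u ≤ 1 := by rw [hcdf]; exact ProbabilityTheory.cdf_le_one _ _
        exact abs_le.mpr ⟨by linarith [h1.1], by linarith [h1.2]⟩
      have h4 := le_ciSup hbd t
      have h5 := le_abs_self (Hhat ω t - H t)
      have h6 : s ≤ t := csInf_le hbdd (show q - ε ≤ H t by
        linarith [not_le.mp hB])
      exact EReal.coe_le_coe_iff.mpr (hω'.trans h6)
  have h7 := (measureReal_mono (μ := P) hsub).trans (measureReal_union_le _ _)
  have h8 := hH s
  simp only [measureReal_def] at h7
  linarith
end

section
/- Let θ̂ be a real random variable on a probability space (Ω, P) with cumulative distribution function H (i.e., H(t) = P(θ̂ ≤ t)), and let Ĥ : Ω → (ℝ → [0,1]) be a random nondecreasing function on the same space. For a nondecreasing G : ℝ → [0,1], write G⁻¹(p) = inf{ t ∈ ℝ : G(t) ≥ p } (with inf ∅ = +∞). Then for every p ∈ (0,1) and every ε > 0 with p + ε < 1: P( θ̂ ≥ Ĥ⁻¹(p) ) ≥ 1 − p − ε − P( sup_{t ∈ ℝ} |Ĥ(t) − H(t)| ≥ ε ). -/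
open MeasureTheory

lemma aux_seq {Ω : Type*} [MeasurableSpace Ω] (P : Measure Ω) [IsProbabilityMeasure P]
    (θ : Ω → ℝ) (q : ℝ) (S : Set ℝ) (u : ℕ → ℝ) (hu : Monotone u)
    (hq : ∀ n, (P {ω | θ ω ≤ u n}).toReal ≤ q) (hc : ∀ t ∈ S, ∃ n, t ≤ u n) :
    (P {ω | θ ω ∈ S}).toReal ≤ q := by
  have hq0 : 0 ≤ q := le_trans ENNReal.toReal_nonneg (hq 0)
  have hsub : {ω | θ ω ∈ S} ⊆ ⋃ n, {ω | θ ω ≤ u n} := by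
    intro ω hω
    obtain ⟨n, hn⟩ := hc _ hω
    exact Set.mem_iUnion.2 ⟨n, hn⟩
  have hm : Monotone (fun n => {ω | θ ω ≤ u n}) := by
    intro a b hab ω hω
    exact le_trans hω (hu hab)
  apply ENNReal.toReal_le_of_le_ofReal hq0
  refine (measure_mono hsub).trans ?_
  rw [hm.measure_iUnion]
  refine iSup_le fun n => ?_
  exact (ENNReal.le_ofReal_iff_toReal_le (measure_ne_top _ _) hq0).2 (hq n)

lemma aux_tail {Ω : Type*} [MeasurableSpace Ω] (P : Measure Ω) [IsProbabilityMeasure P]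
    (θ : Ω → ℝ) (H : ℝ → ℝ) (hH : ∀ t, H t = (P {ω | θ ω ≤ t}).toReal)
    (q : ℝ) (hq : 0 ≤ q) :
    (P {ω | H (θ ω) < q}).toReal ≤ q := by
  have hmono : Monotone H := by
    intro a b hab
    rw [hH, hH]
    exact ENNReal.toReal_mono (measure_ne_top _ _)
      (measure_mono fun ω hω => le_trans hω hab)
  set S : Set ℝ := {t | H t < q} with hS
  change (P {ω | θ ω ∈ S}).toReal ≤ q
  rcases S.eq_empty_or_nonempty with he | hne
  · simpa [he] using hq
  by_cases hb : BddAbove S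
  · by_cases hs : sSup S ∈ S
    · refine aux_seq P θ q S (fun _ => sSup S) monotone_const (fun _ => ?_)
        (fun t ht => ⟨0, le_csSup hb ht⟩)
      rw [← hH]
      exact le_of_lt hs
    · obtain ⟨u, hu, hut, huS⟩ := exists_seq_tendsto_sSup hne hb
      refine aux_seq P θ q S u hu (fun n => ?_) (fun t ht => ?_)
      · rw [← hH]
        exact le_of_lt (huS n)
      · have hlt : t < sSup S := lt_of_le_of_ne (le_csSup hb ht) (fun h => hs (h ▸ ht))
        obtain ⟨n, hn⟩ := (hut.eventually (lt_mem_nhds hlt)).exists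
        exact ⟨n, hn.le⟩
  · refine aux_seq P θ q S (fun n => (n : ℝ)) Nat.mono_cast (fun n => ?_)
      (fun t _ => exists_nat_ge t)
    rw [← hH]
    obtain ⟨t, ht, hnt⟩ := not_bddAbove_iff.1 hb n
    exact (hmono hnt.le).trans (le_of_lt ht)

/-- lower-tail counterpart from the proof of Lemma 2 of the paper.
If H is the CDF of θ̂ under P and Ĥ : Ω → (ℝ → [0,1]) is a random nondecreasing function,
then for every p ∈ (0,1) and ε > 0 with p + ε < 1,
P(θ̂ ≥ Ĥ⁻¹(p)) ≥ 1 − p − ε − P(sup_t |Ĥ(t) − H(t)| ≥ ε). -/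
theorem lower_tail_coverage_bound
    {Ω : Type*} [MeasurableSpace Ω] (P : Measure Ω) [IsProbabilityMeasure P]
    (θhat : Ω → ℝ) (hθ : Measurable θhat)
    (H : ℝ → ℝ) (hH : ∀ t, H t = (P {ω | θhat ω ≤ t}).toReal)
    (Hhat : Ω → ℝ → ℝ)
    (hmono : ∀ ω, Monotone (Hhat ω))
    (hrange : ∀ ω t, Hhat ω t ∈ Set.Icc (0 : ℝ) 1)
    (p ε : ℝ) (hp : p ∈ Set.Ioo (0 : ℝ) 1) (hε : 0 < ε) (hpε : p + ε < 1) :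
    (P {ω | qinv (Hhat ω) p ≤ (θhat ω : EReal)}).toReal ≥
      1 - p - ε - (P {ω | ε ≤ ⨆ t : ℝ, |Hhat ω t - H t|}).toReal := by
  set A := {ω | qinv (Hhat ω) p ≤ (θhat ω : EReal)}
  set B := {ω | ε ≤ ⨆ t : ℝ, |Hhat ω t - H t|} with hB
  set C := {ω | H (θhat ω) < p + ε} with hC
  have hC1 : (P C).toReal ≤ p + ε := aux_tail P θhat H hH (p + ε) (by linarith [hp.1])
  have hcov : (Set.univ : Set Ω) ⊆ A ∪ B ∪ C := by
    intro ω _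
    by_cases h1 : ω ∈ C
    · exact Or.inr h1
    by_cases h2 : ω ∈ B
    · exact Or.inl (Or.inr h2)
    refine Or.inl (Or.inl ?_)
    have h1' : p + ε ≤ H (θhat ω) := not_lt.1 h1
    have h2' : (⨆ t : ℝ, |Hhat ω t - H t|) < ε := not_le.1 h2
    have hbdd : BddAbove (Set.range fun t : ℝ => |Hhat ω t - H t|) := by
      refine ⟨1, ?_⟩
      rintro _ ⟨t, rfl⟩
      have ha := hrange ω t
      have hb0 : 0 ≤ H t := by rw [hH]; exact ENNReal.toReal_nonneg
      have hb1 : H t ≤ 1 := by rw [hH]; exact measureReal_le_one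
      exact abs_le.2 ⟨by linarith [ha.1], by linarith [ha.2]⟩
    have h3 := (le_ciSup hbdd (θhat ω)).trans_lt h2'
    have h4 := (abs_lt.1 h3).1
    change qinv (Hhat ω) p ≤ (θhat ω : EReal)
    unfold qinv
    apply sInf_le
    exact ⟨θhat ω, show p ≤ Hhat ω (θhat ω) by linarith, rfl⟩
  have h1 : P.real Set.univ ≤ P.real (A ∪ B ∪ C) := measureReal_mono hcov
  have h2 := measureReal_union_le (μ := P) (A ∪ B) C
  have h3 := measureReal_union_le (μ := P) A B
  rw [probReal_univ] at h1
  change P.real C ≤ _ at hC1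
  change P.real A ≥ 1 - p - ε - P.real B
  linarith
end

section
/- Let m ≥ 1, let μ and ν be Borel probability measures on ℝ^m with finite first moments, and define W₁(μ, ν) = sup{ |∫ f dμ − ∫ f dν| : f : ℝ^m → ℝ is 1-Lipschitz (with respect to the Euclidean norm) }. Suppose the pushforward of ν under the first-coordinate projection u ↦ u₁ is the Gaussian distribution N(0, σ²) with σ > 0. Let g : ℝ^m → [0,1] be L-Lipschitz (Euclidean norm), and let x ∈ ℝ and δ > 0. Then | ∫ g(u)·1{u₁ ≤ x} dμ(u) − ∫ g(u)·1{u₁ ≤ x} dν(u) | ≤ (L + 1/δ)·W₁(μ, ν) + δ/(σ√(2π)). -/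
open MeasureTheory ProbabilityTheory Real

/-- Wasserstein-1 distance in Kantorovich–Rubinstein dual form:
`W₁(μ, ν) = sup { |∫ f dμ − ∫ f dν| : f 1-Lipschitz }`. -/
noncomputable def W1 {E : Type*} [MeasurableSpace E] [PseudoMetricSpace E]
    (μ ν : Measure E) : ℝ :=
  ⨆ f : {f : E → ℝ // LipschitzWith 1 f}, |(∫ x, f.1 x ∂μ) - ∫ x, f.1 x ∂ν|

lemma W1_lip_bound {E : Type*} [MeasurableSpace E] [NormedAddCommGroup E] [BorelSpace E]
    [SecondCountableTopology E]
    (μ ν : Measure E) [IsProbabilityMeasure μ] [IsProbabilityMeasure ν]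
    (hμ : Integrable (fun u => ‖u‖) μ) (hν : Integrable (fun u => ‖u‖) ν)
    (f : E → ℝ) (K : ℝ) (hK : 0 < K) (hf : ∀ u v, |f u - f v| ≤ K * ‖u - v‖) :
    |(∫ u, f u ∂μ) - ∫ u, f u ∂ν| ≤ K * W1 μ ν := by
  have key : ∀ (ρ : Measure E) [IsProbabilityMeasure ρ], Integrable (fun u => ‖u‖) ρ →
      ∀ h : E → ℝ, LipschitzWith 1 h → |(∫ u, h u ∂ρ) - h 0| ≤ ∫ u, ‖u‖ ∂ρ := by
    intro ρ _ hρ h hh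
    have hb : ∀ u, |h u - h 0| ≤ ‖u‖ := by
      intro u
      have := hh.dist_le_mul u 0
      simpa [Real.dist_eq] using this
    have hi : Integrable (fun u => h u - h 0) ρ :=
      hρ.mono' (hh.continuous.sub continuous_const).aestronglyMeasurable
        (Filter.Eventually.of_forall hb)
    have hi2 : Integrable h ρ := by
      have := hi.add (integrable_const (h 0))
      refine this.congr (Filter.Eventually.of_forall fun u => ?_)
      simp
    have e : (∫ u, h u ∂ρ) - h 0 = ∫ u, (h u - h 0) ∂ρ := by
      rw [integral_sub hi2 (integrable_const _)]; simp
    rw [e]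
    exact norm_integral_le_of_norm_le (f := fun u => h u - h 0) hρ (Filter.Eventually.of_forall hb)
  have bdd : BddAbove (Set.range fun f : {f : E → ℝ // LipschitzWith 1 f} =>
      |(∫ x, f.1 x ∂μ) - ∫ x, f.1 x ∂ν|) := by
    refine ⟨(∫ u, ‖u‖ ∂μ) + ∫ u, ‖u‖ ∂ν, ?_⟩
    rintro _ ⟨⟨h, hh⟩, rfl⟩
    have h1 := abs_le.1 (key μ hμ h hh)
    have h2 := abs_le.1 (key ν hν h hh)
    exact abs_le.2 ⟨by dsimp only; linarith, by dsimp only; linarith⟩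
  have hl : LipschitzWith 1 (fun u => K⁻¹ * f u) := by
    refine LipschitzWith.of_dist_le_mul fun u v => ?_
    rw [Real.dist_eq, dist_eq_norm, ← mul_sub, abs_mul, abs_of_pos (inv_pos.2 hK),
      inv_mul_le_iff₀ hK]
    simpa using hf u v
  have h := le_ciSup bdd ⟨_, hl⟩
  dsimp only at h
  rw [integral_const_mul, integral_const_mul, ← mul_sub, abs_mul, abs_of_pos (inv_pos.2 hK),
    inv_mul_le_iff₀ hK] at h
  exact h

lemma gaussian_Ioc_le (σ : ℝ) (hσ : 0 < σ) (w : NNReal) (hw : (w : ℝ) = σ ^ 2) (a δ : ℝ) (hδ : 0 < δ) :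
    (gaussianReal 0 w).real (Set.Ioc a (a + δ))
      ≤ δ / (σ * Real.sqrt (2 * Real.pi)) := by
  have hv : w ≠ 0 := by
    intro h
    have h2 : σ ^ 2 = 0 := by rw [← hw, h]; simp
    exact (pow_pos hσ 2).ne' h2
  have hp : 0 < σ * Real.sqrt (2 * Real.pi) := by positivity
  refine ENNReal.toReal_le_of_le_ofReal (by positivity) ?_
  rw [gaussianReal_apply _ hv]
  calc _ ≤ ∫⁻ _ in Set.Ioc a (a + δ), ENNReal.ofReal (σ * Real.sqrt (2 * Real.pi))⁻¹ := by
        refine lintegral_mono fun t => ?_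
        refine ENNReal.ofReal_le_ofReal ?_
        simp only [gaussianPDFReal]
        have e : √(2 * π * (w : ℝ)) = σ * √(2 * π) := by
          rw [hw, Real.sqrt_mul (by positivity), Real.sqrt_sq hσ.le, mul_comm]
        rw [e]
        refine mul_le_of_le_one_right (by positivity) ?_
        refine Real.exp_le_one_iff.2 ?_
        exact div_nonpos_of_nonpos_of_nonneg (by nlinarith [sq_nonneg (t - 0)]) (by positivity)
    _ = _ := by
        rw [setLIntegral_const, Real.volume_Ioc, ← ENNReal.ofReal_mul (by positivity)]
        congr 1
        field_simp
        ring

/-- The ramp: one for `t ≤ c - δ`, zero for `t ≥ c`. -/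
noncomputable def ramp (c δ t : ℝ) : ℝ := max 0 (min 1 ((c - t) / δ))

lemma ramp_nonneg (c δ t : ℝ) : 0 ≤ ramp c δ t := le_max_left _ _
lemma ramp_le_one (c δ t : ℝ) : ramp c δ t ≤ 1 := max_le zero_le_one (min_le_left _ _)
lemma ramp_eq_zero {c δ t : ℝ} (hδ : 0 < δ) (h : c ≤ t) : ramp c δ t = 0 :=
  max_eq_left ((min_le_right _ _).trans (div_nonpos_of_nonpos_of_nonneg (by linarith) hδ.le))
lemma ramp_eq_one {c δ t : ℝ} (hδ : 0 < δ) (h : t ≤ c - δ) : ramp c δ t = 1 := by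
  have : 1 ≤ (c - t) / δ := by rw [le_div_iff₀ hδ]; linarith
  simp [ramp, min_eq_left this]
lemma ramp_lip {δ : ℝ} (hδ : 0 < δ) (c s t : ℝ) :
    |ramp c δ s - ramp c δ t| ≤ 1 / δ * |s - t| := by
  calc _ ≤ |min 1 ((c - s) / δ) - min 1 ((c - t) / δ)| := by
        have := abs_max_sub_max_le_max 0 (min 1 ((c - s) / δ)) 0 (min 1 ((c - t) / δ))
        simpa [ramp] using this
    _ ≤ |(c - s) / δ - (c - t) / δ| := by
        have := abs_min_sub_min_le_max 1 ((c - s) / δ) 1 ((c - t) / δ)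
        simpa using this
    _ = _ := by
        rw [← sub_div, abs_div, abs_of_pos hδ, show c - s - (c - t) = -(s - t) by ring, abs_neg]
        ring

/-- smoothing inequality from the proof of Lemma 3: if μ, ν are Borel probability
measures on ℝ^m with finite first moments, the first-coordinate marginal of ν is N(0, σ²) with
σ > 0, and g : ℝ^m → [0,1] is L-Lipschitz, then for all x ∈ ℝ and δ > 0,
|∫ g·1{u₁ ≤ x} dμ − ∫ g·1{u₁ ≤ x} dν| ≤ (L + 1/δ)·W₁(μ, ν) + δ/(σ√(2π)). -/
theorem smoothing_inequality
    (m : ℕ) (hm : 1 ≤ m)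
    (μ ν : Measure (EuclideanSpace ℝ (Fin m)))
    [IsProbabilityMeasure μ] [IsProbabilityMeasure ν]
    (hμmom : Integrable (fun u => ‖u‖) μ) (hνmom : Integrable (fun u => ‖u‖) ν)
    (σ : ℝ) (hσ : 0 < σ)
    (hν1 : ν.map (fun u => u ⟨0, hm⟩) = gaussianReal 0 (⟨σ ^ 2, sq_nonneg σ⟩ : NNReal))
    (L : ℝ) (hL : 0 ≤ L)
    (g : EuclideanSpace ℝ (Fin m) → ℝ)
    (hgLip : LipschitzWith (Real.toNNReal L) g)
    (hgrange : ∀ u, g u ∈ Set.Icc (0 : ℝ) 1)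
    (x δ : ℝ) (hδ : 0 < δ) :
    |(∫ u, g u * Set.indicator {u : EuclideanSpace ℝ (Fin m) | u ⟨0, hm⟩ ≤ x} 1 u ∂μ) -
        ∫ u, g u * Set.indicator {u : EuclideanSpace ℝ (Fin m) | u ⟨0, hm⟩ ≤ x} 1 u ∂ν| ≤
      (L + 1 / δ) * W1 μ ν + δ / (σ * Real.sqrt (2 * Real.pi)) := by
  set p : EuclideanSpace ℝ (Fin m) → ℝ := fun u => u ⟨0, hm⟩ with hp
  have hpc : Continuous p := by fun_prop
  have hpl : ∀ u v, |p u - p v| ≤ ‖u - v‖ := fun u v => by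
    simpa [hp] using PiLp.norm_apply_le (u - v) (⟨0, hm⟩ : Fin m)
  have hgl : ∀ u v, |g u - g v| ≤ L * ‖u - v‖ := fun u v => by
    have := hgLip.dist_le_mul u v
    rwa [Real.dist_eq, dist_eq_norm, Real.coe_toNNReal L hL] at this
  set S : Set (EuclideanSpace ℝ (Fin m)) := {u | u ⟨0, hm⟩ ≤ x} with hS
  have hSm : MeasurableSet S := measurableSet_le hpc.measurable measurable_const
  have hrc : ∀ c, Continuous fun u => g u * ramp c δ (p u) := fun c => by
    have := hgLip.continuous
    unfold ramp
    fun_prop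
  have hfl : ∀ c u v, |g u * ramp c δ (p u) - g v * ramp c δ (p v)| ≤ (L + 1 / δ) * ‖u - v‖ := by
    intro c u v
    have e : g u * ramp c δ (p u) - g v * ramp c δ (p v)
      = (g u - g v) * ramp c δ (p u) + g v * (ramp c δ (p u) - ramp c δ (p v)) := by ring
    rw [e]
    refine (abs_add_le _ _).trans ?_
    rw [abs_mul, abs_mul, abs_of_nonneg (ramp_nonneg _ _ _), abs_of_nonneg (hgrange v).1, add_mul]
    refine add_le_add ?_ ?_
    · exact (mul_le_of_le_one_right (abs_nonneg _) (ramp_le_one _ _ _)).trans (hgl u v)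
    · refine (mul_le_of_le_one_left (abs_nonneg _) (hgrange v).2).trans ?_
      refine (ramp_lip hδ _ _ _).trans ?_
      exact mul_le_mul_of_nonneg_left (hpl u v) (by positivity)
  have hW : ∀ c, |(∫ u, g u * ramp c δ (p u) ∂μ) - ∫ u, g u * ramp c δ (p u) ∂ν|
      ≤ (L + 1 / δ) * W1 μ ν := fun c =>
    W1_lip_bound μ ν hμmom hνmom _ _ (by positivity) (hfl c)
  have hir : ∀ (ρ : Measure (EuclideanSpace ℝ (Fin m))) [IsProbabilityMeasure ρ] (c : ℝ),
      Integrable (fun u => g u * ramp c δ (p u)) ρ := fun ρ _ c => by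
    refine Integrable.of_bound (hrc c).aestronglyMeasurable 1 (Filter.Eventually.of_forall ?_)
    intro u
    rw [Real.norm_eq_abs, abs_of_nonneg (mul_nonneg (hgrange u).1 (ramp_nonneg _ _ _))]
    exact mul_le_one₀ (hgrange u).2 (ramp_nonneg _ _ _) (ramp_le_one _ _ _)
  have hiI : ∀ (ρ : Measure (EuclideanSpace ℝ (Fin m))) [IsProbabilityMeasure ρ],
      Integrable (fun u => g u * S.indicator 1 u) ρ := fun ρ _ => by
    refine Integrable.of_bound (hgLip.continuous.measurable.mul
      (measurable_one.indicator hSm)).aestronglyMeasurable 1 (Filter.Eventually.of_forall ?_)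
    intro u
    have := hgrange u
    by_cases hu : u ∈ S <;> simp [hu, abs_of_nonneg this.1, this.2]
  have hlow : ∀ u, g u * ramp x δ (p u) ≤ g u * S.indicator 1 u := by
    intro u
    refine mul_le_mul_of_nonneg_left ?_ (hgrange u).1
    by_cases hu : u ∈ S
    · simpa [hu] using ramp_le_one _ _ _
    · have : x ≤ p u := (not_le.1 hu).le
      simp [hu, ramp_eq_zero hδ this]
  have hup : ∀ u, g u * S.indicator 1 u ≤ g u * ramp (x + δ) δ (p u) := by
    intro u
    refine mul_le_mul_of_nonneg_left ?_ (hgrange u).1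
    by_cases hu : u ∈ S
    · have h1 : p u ≤ x + δ - δ := by
        have h0 : p u ≤ x := hu
        linarith
      simp [hu, ramp_eq_one hδ h1]
    · simpa [hu] using ramp_nonneg _ _ _
  have hmT : ∀ a, MeasurableSet (p ⁻¹' Set.Ioc a (a + δ)) := fun a =>
    hpc.measurable measurableSet_Ioc
  have hG : ∀ a, (∫ u, (p ⁻¹' Set.Ioc a (a + δ)).indicator (1 : EuclideanSpace ℝ (Fin m) → ℝ) u ∂ν)
      ≤ δ / (σ * Real.sqrt (2 * Real.pi)) := by
    intro a
    rw [integral_indicator_one (hmT a)]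
    have := gaussian_Ioc_le σ hσ (⟨σ ^ 2, sq_nonneg σ⟩ : NNReal) rfl a δ hδ
    rwa [← hν1, map_measureReal_apply hpc.measurable measurableSet_Ioc] at this
  have hiT : ∀ a, Integrable ((p ⁻¹' Set.Ioc a (a + δ)).indicator (1 : EuclideanSpace ℝ (Fin m) → ℝ)) ν := fun a =>
    (integrable_const (1 : ℝ)).indicator (hmT a)
  -- overshoot of the upper ramp
  have hup2 : ∀ u, g u * ramp (x + δ) δ (p u) ≤
      g u * S.indicator 1 u + (p ⁻¹' Set.Ioc x (x + δ)).indicator (1 : EuclideanSpace ℝ (Fin m) → ℝ) u := by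
    intro u
    have hg := hgrange u
    by_cases hu : u ∈ S
    · have h0 : 0 ≤ (p ⁻¹' Set.Ioc x (x + δ)).indicator (1 : EuclideanSpace ℝ (Fin m) → ℝ) u :=
        Set.indicator_nonneg (fun _ _ => zero_le_one) u
      have := mul_le_of_le_one_right hg.1 (ramp_le_one (x + δ) δ (p u))
      simp only [Set.indicator_of_mem hu, Pi.one_apply]
      linarith
    · have hxu : x < p u := not_le.1 hu
      rw [Set.indicator_of_notMem hu]
      by_cases h2 : p u ≤ x + δ
      · rw [Set.indicator_of_mem (show u ∈ p ⁻¹' Set.Ioc x (x + δ) from ⟨hxu, h2⟩)]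
        have := mul_le_one₀ hg.2 (ramp_nonneg (x + δ) δ (p u)) (ramp_le_one _ _ _)
        simpa using this
      · rw [Set.indicator_of_notMem (show u ∉ p ⁻¹' Set.Ioc x (x + δ) from fun h => h2 h.2),
          ramp_eq_zero hδ (not_le.1 h2).le]
        simp
  have hlow2 : ∀ u, g u * S.indicator 1 u ≤
      g u * ramp x δ (p u) + (p ⁻¹' Set.Ioc (x - δ) (x - δ + δ)).indicator (1 : EuclideanSpace ℝ (Fin m) → ℝ) u := by
    intro u
    have hg := hgrange u
    have h0 : 0 ≤ (p ⁻¹' Set.Ioc (x - δ) (x - δ + δ)).indicator (1 : EuclideanSpace ℝ (Fin m) → ℝ) u :=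
      Set.indicator_nonneg (fun _ _ => zero_le_one) u
    have h1 := mul_nonneg hg.1 (ramp_nonneg x δ (p u))
    by_cases hu : u ∈ S
    · have hxu : p u ≤ x := hu
      simp only [Set.indicator_of_mem hu, Pi.one_apply]
      by_cases h2 : p u ≤ x - δ
      · rw [ramp_eq_one hδ h2]
        linarith
      · rw [Set.indicator_of_mem (show u ∈ p ⁻¹' Set.Ioc (x - δ) (x - δ + δ) from
          ⟨not_le.1 h2, by linarith⟩)]
        simp only [Pi.one_apply]
        linarith [hg.2]
    · rw [Set.indicator_of_notMem hu]
      linarith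
  have a1 := integral_mono (hiI μ) (hir μ (x + δ)) hup
  have a2 := integral_mono (hir μ x) (hiI μ) hlow
  have a3 := integral_mono (hir ν (x + δ)) ((hiI ν).add (hiT x)) hup2
  have a4 := integral_mono (hiI ν) ((hir ν x).add (hiT (x - δ))) hlow2
  simp only [Pi.add_apply] at a3 a4
  rw [integral_add (hiI ν) (hiT x)] at a3
  rw [integral_add (hir ν x) (hiT (x - δ))] at a4
  have b1 := abs_le.1 (hW (x + δ))
  have b2 := abs_le.1 (hW x)
  have c1 := hG x
  have c2 := hG (x - δ)
  exact abs_le.2 ⟨by linarith, by linarith⟩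
end

section
/- Let T and V be independent real random variables with T ~ N(θ, σ²) and V ~ N(0, s²), where σ > 0 and s > 0, and let a ∈ ℝ. Let μ be the conditional law of T given the event {T + V ≥ a}, and define F_θ : ℝ → [0,1] by F_θ(x) = (∫_{t ≤ x} φ(t; θ, σ²)·Φ((t − a)/s) dt)/(1 − Φ((a − θ)/√(σ² + s²))). Then the pushforward of μ under F_θ is the uniform distribution on [0,1]. -/
open MeasureTheory ProbabilityTheory Real

/-- The density φ(x; m, v) of the Gaussian distribution N(m, v) (v = variance). -/
noncomputable def gpdf (m v x : ℝ) : ℝ :=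
  (Real.sqrt (2 * Real.pi * v))⁻¹ * Real.exp (-((x - m) ^ 2) / (2 * v))

/-- The standard normal CDF Φ. -/
noncomputable def stdPhi (x : ℝ) : ℝ := ∫ t in Set.Iic x, gpdf 0 1 t

theorem pit_aux (μ : Measure ℝ) [IsProbabilityMeasure μ] (h0 : ∀ x, μ {x} = 0) :
    μ.map (cdf μ) = volume.restrict (Set.Icc (0 : ℝ) 1) := by
  have hmono : Monotone (cdf μ) := monotone_cdf μ
  have hcont : Continuous (cdf μ) := by
    rw [continuous_iff_continuousAt]
    intro x
    rw [hmono.continuousAt_iff_leftLim_eq_rightLim, StieltjesFunction.rightLim_eq]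
    have h1 := (cdf μ).measure_singleton x
    rw [measure_cdf, h0 x] at h1
    have h2 := ENNReal.ofReal_eq_zero.1 h1.symm
    have h3 := hmono.leftLim_le (le_refl x)
    linarith
  have hivt : ∀ u, 0 < u → u < 1 → ∃ x, cdf μ x = u := by
    intro u hu0 hu1
    have h1 : ∃ a, cdf μ a ≤ u :=
      (((tendsto_cdf_atBot μ).eventually (gt_mem_nhds hu0)).exists).imp fun _ h => h.le
    have h2 : ∃ a, u ≤ cdf μ a :=
      (((tendsto_cdf_atTop μ).eventually (lt_mem_nhds hu1)).exists).imp fun _ h => h.le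
    exact mem_range_of_exists_le_of_exists_ge hcont h1 h2
  have : IsProbabilityMeasure (μ.map (cdf μ)) :=
    Measure.isProbabilityMeasure_map hcont.measurable.aemeasurable
  refine Measure.ext_of_Iic _ _ fun u => ?_
  rw [Measure.map_apply hcont.measurable measurableSet_Iic,
    Measure.restrict_apply measurableSet_Iic]
  rcases lt_or_ge u 0 with hu | hu
  · have e1 : cdf μ ⁻¹' Set.Iic u = ∅ := by
      ext x
      have := cdf_nonneg μ x
      simp only [Set.mem_preimage, Set.mem_Iic, Set.mem_empty_iff_false, iff_false]
      linarith
    have e2 : Set.Iic u ∩ Set.Icc (0:ℝ) 1 = ∅ := by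
      ext x
      simp only [Set.mem_inter_iff, Set.mem_Iic, Set.mem_Icc, Set.mem_empty_iff_false, iff_false]
      rintro ⟨h1, h2, h3⟩
      linarith
    rw [e1, e2]; simp
  rcases le_or_gt 1 u with hu1 | hu1
  · have e1 : cdf μ ⁻¹' Set.Iic u = Set.univ := by
      ext x
      have := cdf_le_one μ x
      simp only [Set.mem_preimage, Set.mem_Iic, Set.mem_univ, iff_true]
      linarith
    have e2 : Set.Iic u ∩ Set.Icc (0:ℝ) 1 = Set.Icc 0 1 := by
      ext x
      simp only [Set.mem_inter_iff, Set.mem_Iic, Set.mem_Icc, and_iff_right_iff_imp]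
      rintro ⟨h2, h3⟩
      linarith
    rw [e1, e2]; simp
  have e2 : Set.Iic u ∩ Set.Icc (0:ℝ) 1 = Set.Icc 0 u := by
    ext x
    simp only [Set.mem_inter_iff, Set.mem_Iic, Set.mem_Icc]
    constructor
    · rintro ⟨h1, h2, h3⟩; exact ⟨h2, h1⟩
    · rintro ⟨h1, h2⟩; exact ⟨h2, h1, by linarith⟩
  rw [e2, Real.volume_Icc, sub_zero]
  apply le_antisymm
  · rw [← ENNReal.ofReal_toReal (measure_ne_top μ (cdf μ ⁻¹' Set.Iic u))]
    apply ENNReal.ofReal_le_ofReal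
    refine le_of_forall_gt_imp_ge_of_dense fun w hw => ?_
    rcases le_or_gt 1 w with hw1 | hw1
    · exact le_trans measureReal_le_one hw1
    obtain ⟨x, hx⟩ := hivt w (by linarith) hw1
    rw [← hx, cdf_eq_real]
    refine measureReal_mono ?_
    intro y hy
    by_contra hxy
    have hxy' : x ≤ y := (not_le.1 hxy).le
    have := hmono hxy'
    have hy' : cdf μ y ≤ u := hy
    linarith
  · rcases hu.eq_or_lt with hu0 | hu0
    · simp [← hu0]
    obtain ⟨x, hx⟩ := hivt u hu0 hu1
    calc ENNReal.ofReal u = μ (Set.Iic x) := by rw [← ofReal_cdf, hx]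
      _ ≤ _ := by
        refine measure_mono fun y hy => ?_
        have : cdf μ y ≤ cdf μ x := hmono hy
        rw [hx] at this
        exact this

theorem gpdf_eq (m : ℝ) (v : NNReal) : gpdf m v = gaussianPDFReal m v := rfl

theorem stdPhi_eq (x : ℝ) : gaussianReal 0 1 (Set.Iic x) = ENNReal.ofReal (stdPhi x) := by
  rw [gaussianReal_apply_eq_integral _ one_ne_zero]
  have := gpdf_eq 0 1
  rw [NNReal.coe_one] at this
  rw [stdPhi, this]

theorem stdPhi_nonneg (x : ℝ) : 0 ≤ stdPhi x := by
  refine integral_nonneg fun t => ?_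
  simp only [gpdf, Pi.zero_apply]
  positivity

theorem stdPhi_eq_real (x : ℝ) : stdPhi x = (gaussianReal 0 1).real (Set.Iic x) := by
  rw [measureReal_def, stdPhi_eq, ENNReal.toReal_ofReal (stdPhi_nonneg x)]

theorem stdPhi_mono : Monotone stdPhi := by
  intro x y h
  rw [stdPhi_eq_real, stdPhi_eq_real]
  exact measureReal_mono (Set.Iic_subset_Iic.2 h)

theorem gauss_Ici (m r a : ℝ) (hr : 0 < r) (v : NNReal) (hv : (v : ℝ) = r ^ 2) :
    gaussianReal m v (Set.Ici a) = ENNReal.ofReal (stdPhi ((m - a) / r)) := by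
  have h1 : gaussianReal m v = (gaussianReal 0 1).map (fun x => m - r * x) := by
    have : (fun x : ℝ => m - r * x) = (fun x => m - x) ∘ (fun x => r * x) := rfl
    rw [this, ← Measure.map_map (by fun_prop) (by fun_prop), gaussianReal_map_const_mul,
      gaussianReal_map_const_sub]
    congr 1
    · ring
    · ext; simp [hv]
  rw [h1, Measure.map_apply (by fun_prop) measurableSet_Ici, ← stdPhi_eq]
  congr 1
  ext x
  simp only [Set.mem_preimage, Set.mem_Ici, Set.mem_Iic]
  rw [le_div_iff₀ hr]
  constructor <;> intro h <;> linarith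

theorem one_sub_stdPhi (y : ℝ) : 1 - stdPhi y = stdPhi (-y) := by
  have h1 := gauss_Ici 0 1 y one_pos 1 (by simp)
  have : NullSingletonClass (gaussianReal 0 1) := nullSingletonClass_gaussianReal one_ne_zero
  have h2 : (gaussianReal 0 1).real (Set.Ici y) = stdPhi (-y) := by
    rw [measureReal_def, h1, ENNReal.toReal_ofReal (stdPhi_nonneg _)]; simp
  rw [← h2, stdPhi_eq_real, measureReal_congr Ioi_ae_eq_Ici.symm, ← Set.compl_Iic,
    probReal_compl_eq_one_sub measurableSet_Iic]

/-- With T ~ N(θ, σ²) and V ~ N(0, s²) independent and μ the conditional law of T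
given {T + V ≥ a}, the CDF F_θ(x) = (∫_{t ≤ x} φ(t; θ, σ²)·Φ((t − a)/s) dt)/
(1 − Φ((a − θ)/√(σ² + s²))) pushes μ forward to the uniform distribution on [0,1]. -/
theorem marginalized_truncation_pivot
    {Ω : Type*} [MeasurableSpace Ω] (P : Measure Ω) [IsProbabilityMeasure P]
    (T V : Ω → ℝ) (hT : Measurable T) (hV : Measurable V)
    (θ σ s : ℝ) (hσ : 0 < σ) (hs : 0 < s)
    (hTlaw : P.map T = gaussianReal θ (⟨σ ^ 2, sq_nonneg σ⟩ : NNReal))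
    (hVlaw : P.map V = gaussianReal 0 (⟨s ^ 2, sq_nonneg s⟩ : NNReal))
    (hindep : IndepFun T V P)
    (a : ℝ)
    (Fθ : ℝ → ℝ)
    (hF : ∀ x, Fθ x = (∫ t in Set.Iic x, gpdf θ (σ ^ 2) t * stdPhi ((t - a) / s)) /
        (1 - stdPhi ((a - θ) / Real.sqrt (σ ^ 2 + s ^ 2)))) :
    ((P[|{ω | a ≤ T ω + V ω}]).map T).map Fθ =
      MeasureTheory.volume.restrict (Set.Icc (0 : ℝ) 1) := by
  set vT : NNReal := ⟨σ ^ 2, sq_nonneg σ⟩ with hvT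
  set vV : NNReal := ⟨s ^ 2, sq_nonneg s⟩ with hvV
  have hvTc : (vT : ℝ) = σ ^ 2 := rfl
  have hvVc : (vV : ℝ) = s ^ 2 := rfl
  have hσ2 : vT ≠ 0 := by
    intro h
    have h' : (vT : ℝ) = 0 := by rw [h]; rfl
    rw [hvTc] at h'
    have : 0 < σ ^ 2 := by positivity
    linarith
  set A : Set Ω := {ω | a ≤ T ω + V ω} with hA
  have hAm : MeasurableSet A := measurableSet_le measurable_const (hT.add hV)
  set r := Real.sqrt (σ ^ 2 + s ^ 2) with hr
  have hr0 : 0 < r := Real.sqrt_pos.2 (by positivity)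
  have hr2 : r ^ 2 = σ ^ 2 + s ^ 2 := Real.sq_sqrt (by positivity)
  -- the probability of selection
  have hPA : P A = ENNReal.ofReal (1 - stdPhi ((a - θ) / r)) := by
    have h1 : P.map (T + V) = gaussianReal (θ + 0) (vT + vV) :=
      gaussianReal_add_gaussianReal_of_indepFun hindep hTlaw hVlaw
    have h2 : P A = P.map (T + V) (Set.Ici a) := by
      rw [Measure.map_apply (hT.add hV) measurableSet_Ici]; rfl
    rw [h2, h1, add_zero, gauss_Ici θ r a hr0 _ (by rw [hr2, NNReal.coe_add, hvTc, hvVc]),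
      one_sub_stdPhi, ← neg_div, neg_sub]
  have hPA0 : P A ≠ 0 := by
    have h1 : P.map (T + V) = gaussianReal (θ + 0) (vT + vV) :=
      gaussianReal_add_gaussianReal_of_indepFun hindep hTlaw hVlaw
    have h2 : P A = P.map (T + V) (Set.Ici a) := by
      rw [Measure.map_apply (hT.add hV) measurableSet_Ici]; rfl
    rw [h2, h1]
    intro h
    have hne : vT + vV ≠ 0 := by
      intro h'
      exact hσ2 (add_eq_zero.1 h').1
    have := gaussianReal_absolutelyContinuous' (θ + 0) hne h
    simp at this
  have : IsProbabilityMeasure (P[|A]) := cond_isProbabilityMeasure hPA0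
  set μ := (P[|A]).map T with hμ
  have : IsProbabilityMeasure μ := Measure.isProbabilityMeasure_map hT.aemeasurable
  have hatom : ∀ x, μ {x} = 0 := by
    intro x
    have hac : μ ≪ P.map T := cond_absolutelyContinuous.map hT
    apply hac
    rw [hTlaw]
    have : NullSingletonClass (gaussianReal θ vT) := nullSingletonClass_gaussianReal hσ2
    exact measure_singleton x
  have hmeas : Measurable fun t => stdPhi ((t - a) / s) :=
    stdPhi_mono.measurable.comp (by fun_prop)
  have hle1 : ∀ y, stdPhi y ≤ 1 := fun y => by rw [stdPhi_eq_real]; exact measureReal_le_one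
  have hgT : gpdf θ (σ ^ 2) = gaussianPDFReal θ vT := gpdf_eq θ vT
  have hjoint : ∀ x, P (A ∩ T ⁻¹' Set.Iic x) =
      ENNReal.ofReal (∫ t in Set.Iic x, gpdf θ (σ ^ 2) t * stdPhi ((t - a) / s)) := by
    intro x
    have hSm : MeasurableSet {p : ℝ × ℝ | a ≤ p.1 + p.2 ∧ p.1 ≤ x} :=
      MeasurableSet.inter (s₁ := {p : ℝ × ℝ | a ≤ p.1 + p.2}) (s₂ := {p : ℝ × ℝ | p.1 ≤ x})
        (measurableSet_le measurable_const (measurable_fst.add measurable_snd))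
        (measurableSet_le measurable_fst measurable_const)
    have h1 : P (A ∩ T ⁻¹' Set.Iic x) =
        P.map (fun ω => (T ω, V ω)) {p : ℝ × ℝ | a ≤ p.1 + p.2 ∧ p.1 ≤ x} := by
      rw [Measure.map_apply (hT.prodMk hV) hSm]; rfl
    rw [h1, (indepFun_iff_map_prod_eq_prod_map_map hT.aemeasurable hV.aemeasurable).1 hindep,
      hTlaw, hVlaw, Measure.prod_apply hSm]
    have h2 : ∀ t, gaussianReal 0 vV (Prod.mk t ⁻¹' {p : ℝ × ℝ | a ≤ p.1 + p.2 ∧ p.1 ≤ x}) =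
        (Set.Iic x).indicator (fun t => ENNReal.ofReal (stdPhi ((t - a) / s))) t := by
      intro t
      by_cases ht : t ≤ x
      · rw [Set.indicator_of_mem (Set.mem_Iic.2 ht)]
        have e : Prod.mk t ⁻¹' {p : ℝ × ℝ | a ≤ p.1 + p.2 ∧ p.1 ≤ x} = Set.Ici (a - t) := by
          ext y
          simp only [Set.mem_preimage, Set.mem_ofPred_eq, Set.mem_Ici, ht, and_true]
          constructor <;> intro h <;> linarith
        rw [e, gauss_Ici 0 s (a - t) hs vV hvVc]
        congr 3
        ring
      · rw [Set.indicator_of_notMem (by simpa using ht)]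
        have e : Prod.mk t ⁻¹' {p : ℝ × ℝ | a ≤ p.1 + p.2 ∧ p.1 ≤ x} = ∅ := by
          ext y
          simp [ht]
        rw [e, measure_empty]
    simp_rw [h2]
    rw [lintegral_indicator measurableSet_Iic, gaussianReal_of_var_ne_zero _ hσ2,
      setLIntegral_withDensity_eq_setLIntegral_mul _ (measurable_gaussianPDF _ _)
        hmeas.ennreal_ofReal measurableSet_Iic, hgT,
      ofReal_integral_eq_lintegral_ofReal]
    · refine lintegral_congr fun t => ?_
      rw [Pi.mul_apply, ENNReal.ofReal_mul (gaussianPDFReal_nonneg _ _ _)]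
      rfl
    · refine Integrable.mul_bdd (c := 1) (integrable_gaussianPDFReal _ _).restrict
        hmeas.aestronglyMeasurable (ae_of_all _ fun t => ?_)
      rw [Real.norm_of_nonneg (stdPhi_nonneg _)]
      exact hle1 _
    · exact ae_of_all _ fun t => mul_nonneg (gaussianPDFReal_nonneg _ _ _) (stdPhi_nonneg _)
  have hFc : Fθ = cdf μ := by
    funext x
    rw [hF, cdf_eq_real, measureReal_def, hμ, Measure.map_apply hT measurableSet_Iic,
      cond_apply hAm, hjoint, hPA, ENNReal.toReal_mul, ENNReal.toReal_inv,
      ENNReal.toReal_ofReal, ENNReal.toReal_ofReal, div_eq_inv_mul]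
    · refine integral_nonneg fun t => mul_nonneg ?_ (stdPhi_nonneg _)
      rw [hgT]
      exact gaussianPDFReal_nonneg _ _ _
    · linarith [hle1 ((a - θ) / r)]
  rw [hFc]
  exact pit_aux μ hatom
end
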